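/- The integral ∫_{t_p}^{t_i} max_{θ∈[0,1]} [ e^{2β(σ,θ)} (K(σ,θ) − A(σ,θ) J(σ,θ))² ] dσ is finite; equivalently, ∫_t^{t_i} max_{θ∈[0,1]} [e^{2β}(K − AJ)²](σ,·) dσ is bounded uniformly for t ∈ (t_p,t_i]. -/

import Mathlib

open MeasureTheory Set

noncomputable section

set_option linter.unusedVariables false

/-- the velocity space `ℝ³` -/
abbrev V3 : Type := ℝ × ℝ × ℝ

/-- partial derivative with respect to the time variable `t` -/
def pt (F : ℝ → ℝ → ℝ) : ℝ → ℝ → ℝ := fun t θ => deriv (fun s => F s θ) t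

/-- partial derivative with respect to the space variable `θ` -/
def pθ (F : ℝ → ℝ → ℝ) : ℝ → ℝ → ℝ := fun t θ => deriv (fun x => F t x) θ

/-- time derivative within `Ici tp` (one-sided at the left endpoint `tp`) -/
def ptW (tp : ℝ) (F : ℝ → ℝ → ℝ) : ℝ → ℝ → ℝ :=
  fun t θ => derivWithin (fun s => F s θ) (Set.Ici tp) t

/-- time derivative of the matter distribution function -/
def ptf (f : ℝ → ℝ → V3 → ℝ) (t θ : ℝ) (v : V3) : ℝ := deriv (fun s => f s θ v) t

/-- one-sided time derivative of the matter distribution function -/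
def ptWf (tp : ℝ) (f : ℝ → ℝ → V3 → ℝ) (t θ : ℝ) (v : V3) : ℝ :=
  derivWithin (fun s => f s θ v) (Set.Ici tp) t

/-- `θ`-derivative of the matter distribution function -/
def pθf (f : ℝ → ℝ → V3 → ℝ) (t θ : ℝ) (v : V3) : ℝ := deriv (fun x => f t x v) θ

/-- derivative in the first velocity variable `v₁` -/
def pv1 (g : V3 → ℝ) (v : V3) : ℝ := deriv (fun y => g (y, v.2.1, v.2.2)) v.1

/-- derivative in the second velocity variable `v₂` -/
def pv2 (g : V3 → ℝ) (v : V3) : ℝ := deriv (fun y => g (v.1, y, v.2.2)) v.2.1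

/-- derivative in the third velocity variable `v₃` -/
def pv3 (g : V3 → ℝ) (v : V3) : ℝ := deriv (fun y => g (v.1, v.2.1, y)) v.2.2

/-- the velocity component `v₀ = −√(α e^{2ν−2U} + α v₁² + α e^{2ν−4U} v₂² + α t⁻² e^{2ν} (v₃ − A v₂)²)` -/
def v0 (α ν U A : ℝ → ℝ → ℝ) (t θ : ℝ) (v : V3) : ℝ :=
  - Real.sqrt (α t θ * Real.exp (2 * ν t θ - 2 * U t θ)
    + α t θ * v.1 ^ 2
    + α t θ * Real.exp (2 * ν t θ - 4 * U t θ) * v.2.1 ^ 2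
    + α t θ * (t ^ 2)⁻¹ * Real.exp (2 * ν t θ) * (v.2.2 - A t θ * v.2.1) ^ 2)

/-- `β = ν + (ln α)/2` -/
def betaF (ν α : ℝ → ℝ → ℝ) : ℝ → ℝ → ℝ := fun t θ => ν t θ + Real.log (α t θ) / 2

/-- the energy `𝓔̃(t) = ∫₀¹ ν_t/(√α t) dθ` -/
def Etilde (ν α : ℝ → ℝ → ℝ) (t : ℝ) : ℝ :=
  ∫ θ in (0:ℝ)..1, pt ν t θ / (Real.sqrt (α t θ) * t)

/-- A `C¹` function oscillates on `[0,1]` by at most the integral of `|h'|`. -/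
theorem abs_sub_le_integral_abs_deriv {h : ℝ → ℝ} (hd : Differentiable ℝ h)
    (hc : Continuous (deriv h)) {a b : ℝ} (ha : a ∈ Icc (0 : ℝ) 1) (hb : b ∈ Icc (0 : ℝ) 1) :
    |h b - h a| ≤ ∫ x in (0 : ℝ)..1, |deriv h x| := by
  rw [← intervalIntegral.integral_deriv_eq_sub (fun x _ => hd x) (hc.intervalIntegrable _ _)]
  refine (intervalIntegral.norm_integral_le_integral_norm_uIoc (f := deriv h)).trans ?_
  rw [intervalIntegral.integral_of_le zero_le_one]
  refine setIntegral_mono_set ?_ (Filter.Eventually.of_forall fun x => abs_nonneg _) ?_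
  · exact (hc.abs.integrableOn_Icc).mono_set Ioc_subset_Icc_self
  · refine LE.le.eventuallyLE ?_
    exact Ioc_subset_Ioc (le_min ha.1 hb.1) (max_le ha.2 hb.2)

/-- A velocity moment of a density supported in `|w| ≤ b` is at most `b` times its mass. -/
theorem abs_integral_mul_le_of_support {g w : V3 → ℝ} {b : ℝ} (hg : Integrable g)
    (hg0 : ∀ v, 0 ≤ g v) (hs : ∀ v, b < |w v| → g v = 0) :
    |∫ v, g v * w v| ≤ b * ∫ v, g v := by
  rw [← integral_const_mul]
  refine norm_integral_le_of_norm_le (f := fun v => g v * w v) (hg.const_mul b) (Filter.Eventually.of_forall fun v => ?_)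
  rw [Real.norm_eq_abs, abs_mul, abs_of_nonneg (hg0 v), mul_comm]
  rcases lt_or_ge b |w v| with h | h
  · simp [hs v h]
  · exact mul_le_mul_of_nonneg_right h (hg0 v)

theorem continuousOn_sSup_image_Icc {F : ℝ → ℝ → ℝ} {s : Set ℝ}
    (hF : ContinuousOn (fun p : ℝ × ℝ => F p.1 p.2) (s ×ˢ univ)) :
    ContinuousOn (fun t => sSup (F t '' Icc (0 : ℝ) 1)) s := by
  rw [continuousOn_iff_continuous_domRestrict]
  have h : Continuous fun p : s × ℝ => F p.1 p.2 :=
    hF.comp_continuous (by fun_prop : Continuous fun p : s × ℝ => ((p.1 : ℝ), p.2))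
      fun p => ⟨p.1.2, mem_univ _⟩
  exact isCompact_Icc.continuous_sSup (f := fun (t : s) θ => F t θ) h

theorem contDiff_slice {F : ℝ → ℝ → ℝ} {s : Set ℝ}
    (hF : ContDiffOn ℝ (⊤ : ℕ∞) (fun p : ℝ × ℝ => F p.1 p.2) (s ×ˢ univ)) {t : ℝ} (ht : t ∈ s) :
    ContDiff ℝ (⊤ : ℕ∞) (F t) := by
  have h : ContDiff ℝ (⊤ : ℕ∞) fun θ : ℝ => (t, θ) := by fun_prop
  exact contDiffOn_univ.1 (hF.comp (s := univ) h.contDiffOn fun θ _ => ⟨ht, mem_univ _⟩)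

/-- Spatial control of `e^β |K - A J|` at a fixed time. -/
theorem exp_mul_abs_le_of_moments {β A J K U ρ : ℝ → ℝ} {E B₀ B₁ S C₂ C₄ b₂ b₃ : ℝ}
    (hA : ContDiff ℝ (⊤ : ℕ∞) A) (hJ : ContDiff ℝ (⊤ : ℕ∞) J) (hK : ContDiff ℝ (⊤ : ℕ∞) K)
    (hU : Continuous U) (hb₂ : 0 ≤ b₂) (hb₃ : 0 ≤ b₃) (hE : 0 ≤ E) (hS : 0 ≤ S)
    (hρi : IntervalIntegrable ρ volume 0 1) (hρ : ∀ x, 0 ≤ ρ x)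
    (hρC : ∫ x in (0 : ℝ)..1, ρ x = C₂)
    (hJρ : ∀ x, |deriv J x| ≤ 2 * (b₂ * ρ x)) (hKρ : ∀ x, |deriv K x| ≤ 2 * (b₃ * ρ x))
    (hosc : ∀ x ∈ Icc (0 : ℝ) 1, ∀ y ∈ Icc (0 : ℝ) 1, Real.exp (β x) ≤ E * Real.exp (β y))
    (hB₀ : ∀ x, Real.exp (β x) ≤ B₀) (hB₁ : ∀ x, Real.exp (β x) * |A x| ≤ B₁)
    (hAθ : ∫ x in (0 : ℝ)..1, Real.exp (2 * U x) * |deriv A x| ≤ C₄)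
    (hSJ : ∀ x ∈ Icc (0 : ℝ) 1, Real.exp (β x - 2 * U x) * |J x| ≤ S)
    {a b : ℝ} (ha : a ∈ Icc (0 : ℝ) 1) (hb : b ∈ Icc (0 : ℝ) 1) :
    Real.exp (β b) * |K b - A b * J b| ≤
      E * (Real.exp (β a) * |K a - A a * J a|
        + E * ((2 * b₃ * B₀ + 2 * b₂ * B₁) * C₂ + S * C₄)) := by
  have hAd : Differentiable ℝ A := hA.differentiable (by simp)
  have hJd : Differentiable ℝ J := hJ.differentiable (by simp)
  have hKd : Differentiable ℝ K := hK.differentiable (by simp)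
  have hAc : Continuous (deriv A) := hA.continuous_deriv (by simp)
  set M : ℝ → ℝ := fun x => K x - A x * J x with hM
  have hMs : ContDiff ℝ (⊤ : ℕ∞) M := hK.sub (hA.mul hJ)
  have hMd : Differentiable ℝ M := hMs.differentiable (by simp)
  have hMc : Continuous (deriv M) := hMs.continuous_deriv (by simp)
  have hder : ∀ x, deriv M x = deriv K x - (deriv A x * J x + A x * deriv J x) := fun x =>
    ((hKd x).hasDerivAt.sub ((hAd x).hasDerivAt.mul (hJd x).hasDerivAt)).deriv
  have hpt : ∀ x ∈ Icc (0 : ℝ) 1, Real.exp (β a) * |deriv M x| ≤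
      E * ((2 * b₃ * B₀ + 2 * b₂ * B₁) * ρ x + S * (Real.exp (2 * U x) * |deriv A x|)) := by
    intro x hx
    refine (mul_le_mul_of_nonneg_right (hosc a ha x hx) (abs_nonneg _)).trans ?_
    rw [mul_assoc]
    refine mul_le_mul_of_nonneg_left ?_ hE
    have h1 : |deriv M x| ≤ |deriv K x| + (|deriv A x| * |J x| + |A x| * |deriv J x|) := by
      rw [hder, ← abs_mul, ← abs_mul]
      exact (abs_sub _ _).trans (add_le_add_right (abs_add_le _ _) _)
    have h2 : Real.exp (β x) * |deriv K x| ≤ B₀ * (2 * (b₃ * ρ x)) :=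
      mul_le_mul (hB₀ x) (hKρ x) (abs_nonneg _) ((Real.exp_pos _).le.trans (hB₀ x))
    have h3 : Real.exp (β x) * |A x| * |deriv J x| ≤ B₁ * (2 * (b₂ * ρ x)) :=
      mul_le_mul (hB₁ x) (hJρ x) (abs_nonneg _)
        ((mul_nonneg (Real.exp_pos _).le (abs_nonneg _)).trans (hB₁ x))
    have h4 : Real.exp (β x - 2 * U x) * |J x| * (Real.exp (2 * U x) * |deriv A x|) ≤
        S * (Real.exp (2 * U x) * |deriv A x|) :=
      mul_le_mul_of_nonneg_right (hSJ x hx) (by positivity)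
    have h5 : Real.exp (β x - 2 * U x) * Real.exp (2 * U x) = Real.exp (β x) := by
      rw [← Real.exp_add]; ring_nf
    have h6 : Real.exp (β x - 2 * U x) * |J x| * (Real.exp (2 * U x) * |deriv A x|) =
        Real.exp (β x) * (|deriv A x| * |J x|) := by rw [← h5]; ring
    have h7 := mul_le_mul_of_nonneg_left h1 (Real.exp_pos (β x)).le
    linarith
  have hAi : IntervalIntegrable (fun x => Real.exp (2 * U x) * |deriv A x|) volume 0 1 := by
    apply Continuous.intervalIntegrable
    fun_prop
  have hint : Real.exp (β a) * ∫ x in (0 : ℝ)..1, |deriv M x| ≤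
      E * ((2 * b₃ * B₀ + 2 * b₂ * B₁) * C₂ + S * C₄) := by
    rw [← intervalIntegral.integral_const_mul]
    refine (intervalIntegral.integral_mono_on zero_le_one
      ((hMc.abs.intervalIntegrable _ _).const_mul _)
      (((hρi.const_mul _).add (hAi.const_mul _)).const_mul _) hpt).trans ?_
    rw [intervalIntegral.integral_const_mul,
      intervalIntegral.integral_add (hρi.const_mul _) (hAi.const_mul _),
      intervalIntegral.integral_const_mul, intervalIntegral.integral_const_mul, hρC]
    gcongr
  have hosc' := abs_sub_le_integral_abs_deriv hMd hMc ha hb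
  have hMb : |M b| ≤ |M a| + ∫ x in (0 : ℝ)..1, |deriv M x| := by
    have := abs_sub_abs_le_abs_sub (M b) (M a)
    linarith
  calc Real.exp (β b) * |M b| ≤ E * Real.exp (β a) * |M b| :=
        mul_le_mul_of_nonneg_right (hosc b hb a ha) (abs_nonneg _)
    _ ≤ E * Real.exp (β a) * (|M a| + ∫ x in (0 : ℝ)..1, |deriv M x|) := by gcongr
    _ = E * (Real.exp (β a) * |M a| + Real.exp (β a) * ∫ x in (0 : ℝ)..1, |deriv M x|) := by ring
    _ ≤ _ := by gcongr

/-- A nonpositive logarithmic derivative is integrable up to the endpoints. -/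
theorem intervalIntegrable_logDeriv_of_nonpos {g : ℝ → ℝ} {a b : ℝ} (hab : a ≤ b)
    (hc : ContinuousOn g (Icc a b)) (hd : ∀ x ∈ Ioo a b, DifferentiableAt ℝ g x)
    (hpos : ∀ x ∈ Icc a b, 0 < g x) (hle : ∀ x ∈ Ioo a b, deriv g x / g x ≤ 0) :
    IntervalIntegrable (fun x => deriv g x / g x) volume a b := by
  have h : IntegrableOn (fun x => -(deriv g x / g x)) (Ioc a b) := by
    refine intervalIntegral.integrableOn_deriv_of_nonneg (g := fun x => -Real.log (g x))
      (hc.log fun x hx => (hpos x hx).ne').neg (fun x hx => ?_) fun x hx => neg_nonneg.2 (hle x hx)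
    exact ((hd x hx).hasDerivAt.log (hpos x (Ioo_subset_Icc_self hx)).ne').neg
  rw [intervalIntegrable_iff_integrableOn_Ioc_of_le hab]
  simpa using h.neg

theorem sq_add_add_le (x y z : ℝ) : (x + y + z) ^ 2 ≤ 3 * (x ^ 2 + y ^ 2 + z ^ 2) := by
  nlinarith [sq_nonneg (x - y), sq_nonneg (y - z), sq_nonneg (x - z)]

theorem integral_sup_K_term_bounded
    (tp ti : ℝ) (htp : 0 < tp) (hti : tp < ti)
    (U A ν α J K : ℝ → ℝ → ℝ) (f : ℝ → ℝ → V3 → ℝ)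
    (vb2 vb3 : ℝ) (hv2 : 0 < vb2) (hv3 : 0 < vb3)
    (hsuppv : ∀ t ∈ Ioc tp ti, ∀ (θ : ℝ) (v : V3), vb2 < |v.2.1| ∨ vb3 < |v.2.2| → f t θ v = 0)
    (hUsm : ContDiffOn ℝ (⊤ : ℕ∞) (fun p : ℝ × ℝ => U p.1 p.2) (Ioc tp ti ×ˢ (univ : Set ℝ)))
    (hAsm : ContDiffOn ℝ (⊤ : ℕ∞) (fun p : ℝ × ℝ => A p.1 p.2) (Ioc tp ti ×ˢ (univ : Set ℝ)))
    (hνsm : ContDiffOn ℝ (⊤ : ℕ∞) (fun p : ℝ × ℝ => ν p.1 p.2) (Ioc tp ti ×ˢ (univ : Set ℝ)))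
    (hαsm : ContDiffOn ℝ (⊤ : ℕ∞) (fun p : ℝ × ℝ => α p.1 p.2) (Ioc tp ti ×ˢ (univ : Set ℝ)))
    (hJsm : ContDiffOn ℝ (⊤ : ℕ∞) (fun p : ℝ × ℝ => J p.1 p.2) (Ioc tp ti ×ˢ (univ : Set ℝ)))
    (hKsm : ContDiffOn ℝ (⊤ : ℕ∞) (fun p : ℝ × ℝ => K p.1 p.2) (Ioc tp ti ×ˢ (univ : Set ℝ)))
    (hfsm : ContDiffOn ℝ (⊤ : ℕ∞) (fun p : ℝ × ℝ × V3 => f p.1 p.2.1 p.2.2) (Ioc tp ti ×ˢ (univ : Set (ℝ × V3))))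
    (hUper : ∀ t θ, U t (θ + 1) = U t θ)
    (hAper : ∀ t θ, A t (θ + 1) = A t θ)
    (hνper : ∀ t θ, ν t (θ + 1) = ν t θ)
    (hαper : ∀ t θ, α t (θ + 1) = α t θ)
    (hJper : ∀ t θ, J t (θ + 1) = J t θ)
    (hKper : ∀ t θ, K t (θ + 1) = K t θ)
    (hfper : ∀ t θ v, f t (θ + 1) v = f t θ v)
    (hαpos : ∀ t ∈ Ioc tp ti, ∀ θ : ℝ, 0 < α t θ)
    (hfnn : ∀ t ∈ Ioc tp ti, ∀ (θ : ℝ) (v : V3), 0 ≤ f t θ v)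
    (hfsupp : ∀ t ∈ Ioc tp ti, ∃ R : ℝ, ∀ (θ : ℝ) (v : V3), R < ‖v‖ → f t θ v = 0)
    (halt :
      ∀ t ∈ Ioc tp ti, ∀ θ : ℝ,
      (pt α t θ) / α t θ
        = - (α t θ * Real.exp (2 * ν t θ - 4 * U t θ) * J t θ ^ 2 / t)
          - α t θ * Real.exp (2 * ν t θ) * (K t θ - A t θ * J t θ) ^ 2 / t ^ 3
          - 2 * (α t θ * Real.sqrt (α t θ)) * Real.exp (2 * ν t θ)
            * ∫ v : V3, f t θ v
                * (Real.exp (-2 * U t θ) + Real.exp (-4 * U t θ) * v.2.1 ^ 2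
                    + (t ^ 2)⁻¹ * (v.2.2 - A t θ * v.2.1) ^ 2)
                / |v0 α ν U A t θ v|)
    (hjth :
      ∀ t ∈ Ioc tp ti, ∀ θ : ℝ,
      (pθ J t θ) = 2 * ∫ v : V3, f t θ v * v.2.1)
    (hkth :
      ∀ t ∈ Ioc tp ti, ∀ θ : ℝ,
      (pθ K t θ) = 2 * ∫ v : V3, f t θ v * v.2.2)
    (hnuth :
      ∀ t ∈ Ioc tp ti, ∀ θ : ℝ,
      (pθ ν t θ)
        = 2 * t * ((pt U t θ) * (pθ U t θ) + Real.exp (4 * U t θ) / (4 * t ^ 2) * (pt A t θ) * (pθ A t θ))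
          - (pθ α t θ) / (2 * α t θ)
          - Real.sqrt (α t θ) * ∫ v : V3, f t θ v * v.1)
    (h1 : ∃ θb ∈ Icc (0:ℝ) 1, ∃ C : ℝ, ∀ t ∈ Ioc tp ti,
      |∫ σ in t..ti, pt α σ θb / α σ θb| ≤ C)
    (h2 : ∀ b : ℝ, ∃ C : ℝ, ∀ t ∈ Ioc tp ti, ∀ θ : ℝ,
      Real.exp (betaF ν α t θ + b * U t θ) ≤ C)
    (h2' : ∀ r : ℝ, 0 < r → ∀ b : ℝ, ∃ C : ℝ, ∀ t ∈ Ioc tp ti, ∀ θ : ℝ,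
      |Real.exp (r * betaF ν α t θ + b * U t θ) * A t θ| ≤ C)
    (h3 : ∃ C₄ : ℝ, 0 < C₄ ∧ ∀ t ∈ Ioc tp ti,
      (∫ θ in (0:ℝ)..1, |pθ (betaF ν α) t θ|) < C₄
      ∧ (∫ θ in (0:ℝ)..1, Real.exp (2 * U t θ) * |pθ A t θ|) < C₄
      ∧ ∀ θ₁ ∈ Icc (0:ℝ) 1, ∀ θ₂ ∈ Icc (0:ℝ) 1,
        |betaF ν α t θ₁ - betaF ν α t θ₂| < C₄)
    (h4 : ∃ C : ℝ, ∀ t ∈ Ioc tp ti,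
      (∫ σ in t..ti,
        sSup ((fun θ => Real.exp (2 * betaF ν α σ θ - 4 * U σ θ) * J σ θ ^ 2) '' Icc (0:ℝ) 1)) ≤ C)
    (C₁ C₂ : ℝ) (hC₂pos : 0 < C₂)
    (hC₂const : ∀ t ∈ Ioc tp ti, (∫ θ in (0:ℝ)..1, ∫ v : V3, f t θ v) = C₂)
    (hC₁bdd : ∀ t ∈ Ioc tp ti, ∀ (θ : ℝ) (v : V3), f t θ v ≤ C₁) :
    ∃ C : ℝ, ∀ t ∈ Ioc tp ti,
      (∫ σ in t..ti,
        sSup ((fun θ => Real.exp (2 * betaF ν α σ θ)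
          * (K σ θ - A σ θ * J σ θ) ^ 2) '' Icc (0:ℝ) 1)) ≤ C := by
  obtain ⟨θb, hθb, Cα, hCα⟩ := h1
  obtain ⟨B₀, hB₀⟩ := h2 0
  obtain ⟨B₁, hB₁⟩ := h2' 1 one_pos 0
  obtain ⟨C₄, hC₄, h3⟩ := h3
  obtain ⟨CJ, hCJ⟩ := h4
  set β := betaF ν α with hβ
  have hβc : ContinuousOn (fun p : ℝ × ℝ => β p.1 p.2) (Ioc tp ti ×ˢ univ) :=
    hνsm.continuousOn.add ((hαsm.continuousOn.log fun p hp => (hαpos _ hp.1 _).ne').div_const 2)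
  have hUc := hUsm.continuousOn
  have hAc := hAsm.continuousOn
  have hJc := hJsm.continuousOn
  have hKc := hKsm.continuousOn
  set GJ : ℝ → ℝ → ℝ := fun σ θ => Real.exp (2 * β σ θ - 4 * U σ θ) * J σ θ ^ 2 with hGJ
  set GM : ℝ → ℝ → ℝ :=
    fun σ θ => Real.exp (2 * β σ θ) * (K σ θ - A σ θ * J σ θ) ^ 2 with hGM
  have hGJc : ContinuousOn (fun p : ℝ × ℝ => GJ p.1 p.2) (Ioc tp ti ×ˢ univ) :=
    ((hβc.const_smul (2 : ℝ)).sub (hUc.const_smul (4 : ℝ))).rexp.mul (hJc.pow 2)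
  have hGMc : ContinuousOn (fun p : ℝ × ℝ => GM p.1 p.2) (Ioc tp ti ×ˢ univ) :=
    (hβc.const_smul (2 : ℝ)).rexp.mul ((hKc.sub (hAc.mul hJc)).pow 2)
  have hline : ∀ θ : ℝ, ContinuousOn (fun σ : ℝ => (σ, θ)) (Ioc tp ti) :=
    fun θ => by fun_prop
  have hGMb : ContinuousOn (fun σ => GM σ θb) (Ioc tp ti) :=
    hGMc.comp (hline θb) fun σ hσ => ⟨hσ, mem_univ _⟩
  set SJ : ℝ → ℝ := fun σ => sSup (GJ σ '' Icc (0 : ℝ) 1) with hSJ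
  set SM : ℝ → ℝ := fun σ => sSup (GM σ '' Icc (0 : ℝ) 1) with hSM
  have hSJc : ContinuousOn SJ (Ioc tp ti) := continuousOn_sSup_image_Icc hGJc
  have hSMc : ContinuousOn SM (Ioc tp ti) := continuousOn_sSup_image_Icc hGMc
  have hGJle : ∀ σ ∈ Ioc tp ti, ∀ θ ∈ Icc (0 : ℝ) 1, GJ σ θ ≤ SJ σ := by
    intro σ hσ θ hθ
    have hc : Continuous (GJ σ) := hGJc.comp_continuous (f := fun θ : ℝ => (σ, θ))
      (by fun_prop) fun _ => ⟨hσ, mem_univ _⟩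
    exact le_csSup (isCompact_Icc.image hc).bddAbove (mem_image_of_mem _ hθ)
  have hSJ0 : ∀ σ ∈ Ioc tp ti, 0 ≤ SJ σ := fun σ hσ =>
    (by positivity : 0 ≤ GJ σ θb).trans (hGJle σ hσ θb hθb)
  set E := Real.exp C₄ with hE
  set D := (2 * vb3 * B₀ + 2 * vb2 * B₁) * C₂ with hD
  have hpoint : ∀ σ ∈ Ioc tp ti, SM σ ≤
      3 * E ^ 2 * GM σ θb + 3 * (E ^ 2 * D) ^ 2 + 3 * (E ^ 2 * C₄) ^ 2 * SJ σ := by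
    intro σ hσ
    have hfi : ∀ θ, Integrable (f σ θ) := by
      intro θ
      have hc : Continuous (f σ θ) := hfsm.continuousOn.comp_continuous
        (f := fun v : V3 => (σ, θ, v)) (by fun_prop) fun _ => ⟨hσ, mem_univ _⟩
      obtain ⟨R, hR⟩ := hfsupp σ hσ
      refine hc.integrable_of_hasCompactSupport
        (HasCompactSupport.intro (isCompact_closedBall (0 : V3) R) fun v hv => hR θ v ?_)
      simpa using hv
    have hρi : IntervalIntegrable (fun θ => ∫ v, f σ θ v) volume 0 1 := by
      by_contra h
      have := hC₂const σ hσ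
      rw [intervalIntegral.integral_undef h] at this
      exact hC₂pos.ne this
    have hJρ : ∀ x, |deriv (J σ) x| ≤ 2 * (vb2 * ∫ v, f σ x v) := by
      intro x
      have h := hjth σ hσ x
      change deriv (J σ) x = _ at h
      rw [h, abs_mul, abs_two]
      exact mul_le_mul_of_nonneg_left (abs_integral_mul_le_of_support (hfi x) (hfnn σ hσ x)
        fun v hv => hsuppv σ hσ x v (Or.inl hv)) zero_le_two
    have hKρ : ∀ x, |deriv (K σ) x| ≤ 2 * (vb3 * ∫ v, f σ x v) := by
      intro x
      have h := hkth σ hσ x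
      change deriv (K σ) x = _ at h
      rw [h, abs_mul, abs_two]
      exact mul_le_mul_of_nonneg_left (abs_integral_mul_le_of_support (hfi x) (hfnn σ hσ x)
        fun v hv => hsuppv σ hσ x v (Or.inr hv)) zero_le_two
    have hkey : ∀ θ ∈ Icc (0 : ℝ) 1, _ := fun θ hθ => exp_mul_abs_le_of_moments
      (β := β σ) (A := A σ) (J := J σ) (K := K σ) (U := U σ) (ρ := fun θ => ∫ v, f σ θ v)
      (E := E) (B₀ := B₀) (B₁ := B₁) (S := √(SJ σ)) (C₂ := C₂) (C₄ := C₄) (b₂ := vb2) (b₃ := vb3)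
      (contDiff_slice hAsm hσ) (contDiff_slice hJsm hσ) (contDiff_slice hKsm hσ)
      (contDiff_slice hUsm hσ).continuous hv2.le hv3.le (Real.exp_pos _).le (Real.sqrt_nonneg _)
      hρi (fun x => integral_nonneg (hfnn σ hσ x)) (hC₂const σ hσ) hJρ hKρ
      (fun x hx y hy => by
        rw [hE, ← Real.exp_add, Real.exp_le_exp]
        linarith [(abs_lt.1 ((h3 σ hσ).2.2 x hx y hy)).2])
      (fun x => by simpa using hB₀ σ hσ x)
      (fun x => by simpa [abs_mul] using hB₁ σ hσ x)
      (h3 σ hσ).2.1.le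
      (fun x hx => by
        refine Real.le_sqrt_of_sq_le ((hGJle σ hσ x hx).trans' (le_of_eq ?_))
        rw [mul_pow, sq_abs, ← Real.exp_nat_mul, hGJ]
        push_cast
        ring_nf)
      hθb hθ
    refine csSup_le ((nonempty_Icc.2 zero_le_one).image _) ?_
    rintro _ ⟨θ, hθ, rfl⟩
    have hsq : ∀ θ, (Real.exp (β σ θ) * |K σ θ - A σ θ * J σ θ|) ^ 2 = GM σ θ := by
      intro θ
      rw [mul_pow, sq_abs, ← Real.exp_nat_mul, hGM]
      push_cast
      rfl
    have hle := pow_le_pow_left₀ (by positivity) (hkey θ hθ) 2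
    rw [hsq] at hle
    refine hle.trans ?_
    have h := sq_add_add_le (E * (Real.exp (β σ θb) * |K σ θb - A σ θb * J σ θb|)) (E ^ 2 * D)
      (E ^ 2 * C₄ * √(SJ σ))
    rw [mul_pow, hsq, mul_pow _ (√(SJ σ)), Real.sq_sqrt (hSJ0 σ hσ)] at h
    refine Eq.trans_le ?_ (h.trans (le_of_eq ?_)) <;> ring
  have hmatter : ∀ σ ∈ Ioc tp ti, GM σ θb ≤ ti ^ 3 * -(pt α σ θb / α σ θb) := by
    intro σ hσ
    have hσ0 : 0 < σ := htp.trans hσ.1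
    have ha := hαpos σ hσ θb
    have hint : 0 ≤ ∫ v : V3, f σ θb v
        * (Real.exp (-2 * U σ θb) + Real.exp (-4 * U σ θb) * v.2.1 ^ 2
          + (σ ^ 2)⁻¹ * (v.2.2 - A σ θb * v.2.1) ^ 2) / |v0 α ν U A σ θb v| :=
      integral_nonneg fun v => div_nonneg (mul_nonneg (hfnn σ hσ θb v) (by positivity))
        (abs_nonneg _)
    have hGMα : GM σ θb = α σ θb * Real.exp (2 * ν σ θb) * (K σ θb - A σ θb * J σ θb) ^ 2 := by
      have : 2 * β σ θb = Real.log (α σ θb) + 2 * ν σ θb := by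
        rw [hβ, betaF]; ring
      simp only [hGM]
      rw [this, Real.exp_add, Real.exp_log ha]
    have hdiv : GM σ θb / σ ^ 3 ≤ -(pt α σ θb / α σ θb) := by
      rw [halt σ hσ θb, ← hGMα]
      have p1 : 0 ≤ α σ θb * Real.exp (2 * ν σ θb - 4 * U σ θb) * J σ θb ^ 2 / σ := by positivity
      have p2 := mul_nonneg (by positivity :
        0 ≤ 2 * (α σ θb * √(α σ θb)) * Real.exp (2 * ν σ θb)) hint
      linarith
    rw [div_le_iff₀ (by positivity), mul_comm] at hdiv
    refine hdiv.trans (mul_le_mul_of_nonneg_right (pow_le_pow_left₀ hσ0.le hσ.2 3) ?_)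
    exact nonneg_of_mul_nonneg_right ((by positivity : 0 ≤ GM σ θb).trans hdiv) (by positivity)
  refine ⟨3 * E ^ 2 * (ti ^ 3 * Cα) + (ti - tp) * (3 * (E ^ 2 * D) ^ 2)
    + 3 * (E ^ 2 * C₄) ^ 2 * CJ, fun t ht => ?_⟩
  have hsub : Icc t ti ⊆ Ioc tp ti := fun σ hσ => ⟨ht.1.trans_le hσ.1, hσ.2⟩
  have hii : ∀ {g : ℝ → ℝ}, ContinuousOn g (Ioc tp ti) → IntervalIntegrable g volume t ti :=
    fun hg => (hg.mono hsub).intervalIntegrable_of_Icc ht.2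
  have hlog : IntervalIntegrable (fun σ => pt α σ θb / α σ θb) volume t ti := by
    refine intervalIntegrable_logDeriv_of_nonpos (g := fun σ => α σ θb) ht.2
      ((hαsm.continuousOn.comp (hline θb) fun σ hσ => ⟨hσ, mem_univ _⟩).mono hsub)
      (fun σ hσ => ?_) (fun σ hσ => hαpos σ (hsub hσ) θb) fun σ hσ => ?_
    · have hnhds : Ioc tp ti ×ˢ (univ : Set ℝ) ∈ nhds (σ, θb) :=
        prod_mem_nhds (Ioc_mem_nhds (ht.1.trans hσ.1) hσ.2) Filter.univ_mem
      exact DifferentiableAt.comp σ (f := fun σ : ℝ => (σ, θb))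
        (g := fun p : ℝ × ℝ => α p.1 p.2) ((hαsm.contDiffAt hnhds).differentiableAt (by simp))
        (by fun_prop)
    · have h := (by positivity : 0 ≤ GM σ θb).trans (hmatter σ (hsub (Ioo_subset_Icc_self hσ)))
      have hti3 : 0 < ti ^ 3 := pow_pos (htp.trans hti) 3
      exact neg_nonneg.1 (nonneg_of_mul_nonneg_right h hti3)
  have hGMint : ∫ σ in t..ti, GM σ θb ≤ ti ^ 3 * Cα := by
    refine (intervalIntegral.integral_mono_on ht.2 (hii hGMb) (hlog.neg.const_mul _)
      fun σ hσ => hmatter σ (hsub hσ)).trans ?_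
    simp only [Pi.neg_apply]
    rw [intervalIntegral.integral_const_mul, intervalIntegral.integral_neg]
    exact mul_le_mul_of_nonneg_left ((neg_le_abs _).trans (hCα t ht))
      (pow_pos (htp.trans hti) 3).le
  have i1 := (hii hGMb).const_mul (3 * E ^ 2)
  have i2 : IntervalIntegrable (fun _ : ℝ => 3 * (E ^ 2 * D) ^ 2) volume t ti :=
    intervalIntegrable_const
  have i3 := (hii hSJc).const_mul (3 * (E ^ 2 * C₄) ^ 2)
  refine (intervalIntegral.integral_mono_on ht.2 (hii hSMc) ((i1.add i2).add i3)
    fun σ hσ => hpoint σ (hsub hσ)).trans ?_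
  rw [intervalIntegral.integral_add (i1.add i2) i3, intervalIntegral.integral_add i1 i2,
    intervalIntegral.integral_const, smul_eq_mul, intervalIntegral.integral_const_mul,
    intervalIntegral.integral_const_mul]
  have hJt : ∫ σ in t..ti, SJ σ ≤ CJ := hCJ t ht
  have htt : (ti - t) * (3 * (E ^ 2 * D) ^ 2) ≤ (ti - tp) * (3 * (E ^ 2 * D) ^ 2) :=
    mul_le_mul_of_nonneg_right (by linarith [ht.1]) (by positivity)
  exact add_le_add (add_le_add (mul_le_mul_of_nonneg_left hGMint (by positivity)) htt)
    (mul_le_mul_of_nonneg_left hJt (by positivity))
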